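/- arXiv:2105.14456 — 2 statements merged into one kernel-verified Lean document; each statement's English description precedes it below -/
import Mathlib

section
/- Every extra-special 2-group G has exactly one nonlinear irreducible character, and all |G/G'| − 1 nontrivial linear characters of G have codegree 2; hence G is a T'_{|G/G'|−1}-group. -/
open CategoryTheory

def Irr (G : Type) [Group G] [Fintype G] : Set (G → ℂ) :=
  {χ | ∃ V : FDRep ℂ G, Simple V ∧ χ = V.character}

noncomputable def charDeg (G : Type) [Group G] (χ : G → ℂ) : ℕ := Nat.floor (χ 1).re

def kerSet (G : Type) [Group G] (χ : G → ℂ) : Set G := {g | χ g = χ 1}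

noncomputable def cod (G : Type) [Group G] [Fintype G] (χ : G → ℂ) : ℕ :=
  Fintype.card G / (kerSet G χ).ncard / charDeg G χ

def codSet (G : Type) [Group G] [Fintype G] : Set ℕ := {d | ∃ χ ∈ Irr G, cod G χ = d}

noncomputable def codMult (G : Type) [Group G] [Fintype G] (d : ℕ) : ℕ :=
  {χ ∈ Irr G | cod G χ = d}.ncard

def IsTk' (G : Type) [Group G] [Fintype G] (k : ℕ) : Prop :=
  ∃ d₀ ∈ codSet G, codMult G d₀ = k ∧ ∀ d ∈ codSet G, d ≠ d₀ → codMult G d = 1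

def IsExtraspecial (p : ℕ) (G : Type) [Group G] : Prop :=
  IsPGroup p G ∧ Subgroup.center G = commutator G ∧
    Nat.card (Subgroup.center G) = p

theorem FDRep.exists_eq_smul_one_of_commute {G : Type} [Group G] (V : FDRep ℂ G) [Simple V]
    (f : V →ₗ[ℂ] V) (hf : ∀ g, Commute f (V.ρ g)) : ∃ c : ℂ, f = c • 1 := by
  let F : V ⟶ V := ⟨InducedCategory.homMk (ModuleCat.ofHom f), fun g ↦ by
    ext x
    exact LinearMap.congr_fun (hf g).eq x⟩
  obtain ⟨c, hc⟩ := (finrank_eq_one_iff_of_nonzero' (𝟙 V) (id_nonzero V)).mp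
    (finrank_endomorphism_simple_eq_one ℂ V) F
  refine ⟨c, ?_⟩
  exact congrArg (fun e : V ⟶ V ↦ e.hom.hom.hom) hc.symm

theorem FDRep.simple_of_isIrreducible {G : Type} [Group G] [Fintype G] {V : Type}
    [AddCommGroup V] [Module ℂ V] [FiniteDimensional ℂ V] (ρ : Representation ℂ G V)
    [ρ.IsIrreducible] : Simple (FDRep.of ρ) := by
  have := invertibleOfNonzero (NeZero.ne (Nat.card G : ℂ))
  rw [FDRep.simple_iff_char_is_norm_one]
  have key := Representation.card_inv_mul_sum_char_mul_char_eq_finrank ρ ρ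
  rw [Representation.IsIrreducible.finrank_intertwiningMap_self, Nat.cast_one,
    inv_mul_eq_one₀ (NeZero.ne _)] at key
  exact key.symm

theorem Representation.isIrreducible_ofModule' {k G M : Type*} [Field k] [Group G]
    [AddCommGroup M] [Module k M] [Module (MonoidAlgebra k G) M]
    [IsScalarTower k (MonoidAlgebra k G) M] [IsSimpleModule (MonoidAlgebra k G) M] :
    (Representation.ofModule' (k := k) (G := G) M).IsIrreducible := by
  rw [Representation.irreducible_iff_isSimpleModule_asModule]
  let ρ := Representation.ofModule' (k := k) (G := G) M
  let e : ρ.asModule ≃ₗ[MonoidAlgebra k G] M :=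
    { ρ.asModuleEquiv.toAddEquiv with
      map_smul' := fun r x ↦ by
        have h : ρ.asAlgebraHom = Algebra.lsmul k k M := by
          simp [ρ, Representation.asAlgebraHom, Representation.ofModule']
        exact (ρ.asModuleEquiv_map_smul r x).trans
          (congrArg (fun f ↦ f r (ρ.asModuleEquiv x)) h) }
  exact IsSimpleModule.congr e

theorem FDRep.exists_simple_of_isSimpleModule {G : Type} [Group G] [Fintype G] (M : Type)
    [AddCommGroup M] [Module ℂ M] [Module (MonoidAlgebra ℂ G) M]
    [IsScalarTower ℂ (MonoidAlgebra ℂ G) M] [IsSimpleModule (MonoidAlgebra ℂ G) M] :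
    ∃ V : FDRep ℂ G, Simple V ∧
      ∀ g, V.ρ g = 1 → ∀ x : M, MonoidAlgebra.of ℂ G g • x = x := by
  have : Module.Finite ℂ M := Module.Finite.trans (MonoidAlgebra ℂ G) M
  have := Representation.isIrreducible_ofModule' (k := ℂ) (G := G) (M := M)
  exact ⟨FDRep.of (Representation.ofModule' (k := ℂ) (G := G) M),
    FDRep.simple_of_isIrreducible _, fun g hg x ↦ LinearMap.congr_fun hg x⟩

theorem FDRep.exists_simple_rho_ne_one {G : Type} [Group G] [Fintype G] {z : G} (hz : z ≠ 1) :
    ∃ V : FDRep ℂ G, Simple V ∧ V.ρ z ≠ 1 := by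
  by_contra! hV
  have hker : (MonoidAlgebra.of ℂ G z - 1) ∈ Ring.jacobson (MonoidAlgebra ℂ G) := by
    rw [Ring.jacobson, Module.jacobson, Submodule.mem_sInf]
    intro I hI
    have : IsSimpleModule (MonoidAlgebra ℂ G) (MonoidAlgebra ℂ G ⧸ I) :=
      isSimpleModule_iff_isCoatom.mpr hI
    obtain ⟨V, hVs, hVz⟩ :=
      FDRep.exists_simple_of_isSimpleModule (G := G) (MonoidAlgebra ℂ G ⧸ I)
    have h1 := hVz z (hV V hVs) (Submodule.Quotient.mk 1)
    rwa [← Submodule.Quotient.mk_smul, Submodule.Quotient.eq, smul_eq_mul, mul_one] at h1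
  rw [IsSemisimpleRing.jacobson_eq_bot, Submodule.mem_bot, sub_eq_zero] at hker
  exact hz (MonoidAlgebra.of_injective (hker.trans (map_one _).symm))

theorem charDeg_character {G : Type} [Group G] (V : FDRep ℂ G) :
    charDeg G V.character = Module.finrank ℂ V := by
  simp [charDeg]

theorem FDRep.finrank_eq_one_of_forall_eq_smul_one {G : Type} [Group G] [Fintype G]
    (V : FDRep ℂ G) [hV : Simple V] (h : ∀ g, ∃ c : ℂ, V.ρ g = c • 1) :
    Module.finrank ℂ V = 1 := by
  have hterm : ∀ g, V.character g * V.character g⁻¹ = (Module.finrank ℂ V : ℂ) ^ 2 := by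
    intro g
    obtain ⟨c, hc⟩ := h g
    have hinv : V.character g⁻¹ * c = Module.finrank ℂ V := by
      have h1 : c • V.ρ g⁻¹ = 1 := by
        rw [← map_one V.ρ, ← mul_inv_cancel g, map_mul, hc, smul_mul_assoc, one_mul]
      have h2 := congrArg (LinearMap.trace ℂ V) h1
      rw [map_smul, smul_eq_mul, LinearMap.trace_one, mul_comm] at h2
      exact h2
    have hg : V.character g = c * Module.finrank ℂ V := by
      rw [FDRep.character, hc, map_smul, smul_eq_mul, LinearMap.trace_one]
    rw [hg]
    linear_combination (Module.finrank ℂ V : ℂ) * hinv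
  have hnorm := (FDRep.simple_iff_char_is_norm_one V).mp hV
  simp_rw [hterm, Finset.sum_const, Finset.card_univ, nsmul_eq_mul,
    Nat.card_eq_fintype_card] at hnorm
  have hsq := mul_left_cancel₀ (NeZero.ne (Fintype.card G : ℂ)) (hnorm.trans (mul_one _).symm)
  norm_cast at hsq
  simpa using hsq

theorem mem_Irr_and_charDeg_eq_one_iff {G : Type} [Group G] [Fintype G] (χ : G → ℂ) :
    χ ∈ Irr G ∧ charDeg G χ = 1 ↔ ∃ l : G →* ℂˣ, χ = fun g ↦ (l g : ℂ) := by
  constructor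
  · rintro ⟨⟨V, -, rfl⟩, hd⟩
    rw [charDeg_character] at hd
    refine ⟨(LinearMap.det.comp V.ρ).toHomUnits, funext fun g ↦ ?_⟩
    have : Nontrivial V := Module.nontrivial_of_finrank_pos (R := ℂ) (by omega)
    obtain ⟨c, hc⟩ := (finrank_eq_one_iff_of_nonzero' (K := ℂ) (1 : V →ₗ[ℂ] V) one_ne_zero).mp
      (by rw [Module.finrank_linearMap, hd]) (V.ρ g)
    simp [FDRep.character, ← hc, hd]
  · rintro ⟨l, rfl⟩
    let ρ : Representation ℂ G ℂ :=
      (Algebra.lsmul ℂ ℂ ℂ).toMonoidHom.comp ((Units.coeHom ℂ).comp l)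
    have hχ : (FDRep.of ρ).character = fun g ↦ (l g : ℂ) := by
      funext g
      have h1 : ρ g = (l g : ℂ) • (1 : ℂ →ₗ[ℂ] ℂ) := by
        ext
        simp [ρ]
      change LinearMap.trace ℂ ℂ (ρ g) = _
      simp [h1]
    refine ⟨⟨FDRep.of ρ, ?_, hχ.symm⟩, by simp [charDeg]⟩
    rw [FDRep.simple_iff_char_is_norm_one, hχ]
    simp

theorem MonoidHom.units_coe_injective (G M : Type*) [Monoid G] [Monoid M] :
    Function.Injective fun (l : G →* Mˣ) (g : G) ↦ (l g : M) :=
  fun _ _ h ↦ MonoidHom.ext fun g ↦ Units.ext (congrFun h g)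

theorem card_monoidHom_units_complex (G : Type) [Group G] [Finite G] :
    Nat.card (G →* ℂˣ) = Nat.card (G ⧸ commutator G) :=
  (Nat.card_congr Abelianization.lift).trans
    (CommGroup.card_monoidHom_of_hasEnoughRootsOfUnity (Abelianization G) ℂ)

theorem ncard_nontrivial_linear (G : Type) [Group G] [Fintype G] :
    {χ ∈ Irr G | charDeg G χ = 1 ∧ χ ≠ (fun _ => (1 : ℂ))}.ncard =
      Nat.card (G ⧸ commutator G) - 1 := by
  have : Finite (G →* ℂˣ) := Nat.finite_of_card_ne_zero (by
    rw [card_monoidHom_units_complex]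
    exact Nat.card_pos.ne')
  have himage : {χ ∈ Irr G | charDeg G χ = 1 ∧ χ ≠ (fun _ => (1 : ℂ))} =
      (fun (l : G →* ℂˣ) (g : G) ↦ (l g : ℂ)) '' {1}ᶜ := by
    ext χ
    rw [Set.mem_ofPred_eq, ← and_assoc, mem_Irr_and_charDeg_eq_one_iff]
    have htriv : (fun _ ↦ (1 : ℂ)) = fun g : G ↦ ((1 : G →* ℂˣ) g : ℂ) := by simp
    constructor
    · rintro ⟨⟨l, rfl⟩, hl⟩
      exact ⟨l, fun h ↦ hl (by rw [Set.mem_singleton_iff.mp h, htriv]), rfl⟩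
    · rintro ⟨l, hl, rfl⟩
      exact ⟨⟨l, rfl⟩, fun h ↦ hl (MonoidHom.units_coe_injective G ℂ (h.trans htriv))⟩
  rw [himage, Set.ncard_image_of_injective _ (MonoidHom.units_coe_injective G ℂ),
    Set.ncard_compl, Set.ncard_singleton, card_monoidHom_units_complex]

namespace IsExtraspecial

open scoped commutatorElement

variable {G : Type} [Group G]

theorem exists_mem_center_iff (h : IsExtraspecial 2 G) :
    ∃ z : G, z ≠ 1 ∧ z * z = 1 ∧ ∀ g, g ∈ Subgroup.center G ↔ g = 1 ∨ g = z := by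
  obtain ⟨⟨z, hzc⟩, hz1, hz⟩ := (Nat.card_eq_two_iff' (1 : Subgroup.center G)).mp h.2.2
  have hz1' : z ≠ 1 := fun e ↦ hz1 (Subtype.ext e)
  have hcenter : ∀ g, g ∈ Subgroup.center G ↔ g = 1 ∨ g = z := by
    refine fun g ↦ ⟨fun hg ↦ ?_, ?_⟩
    · by_cases hg1 : g = 1
      · exact Or.inl hg1
      · exact Or.inr (congrArg Subtype.val (hz ⟨g, hg⟩ fun e ↦ hg1 (congrArg Subtype.val e)))
    · rintro (rfl | rfl)
      exacts [one_mem _, hzc]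
  refine ⟨z, hz1', ?_, hcenter⟩
  exact ((hcenter (z * z)).mp (mul_mem hzc hzc)).resolve_right fun e ↦ hz1' (mul_eq_left.mp e)

theorem commutatorElement_mem_center (h : IsExtraspecial 2 G) (x y : G) :
    ⁅x, y⁆ ∈ Subgroup.center G := by
  rw [h.2.1]
  exact Subgroup.commutator_mem_commutator (Subgroup.mem_top x) (Subgroup.mem_top y)

theorem center_ne_top (h : IsExtraspecial 2 G) : Subgroup.center G ≠ ⊤ := by
  intro htop
  have hbot := (commutator_eq_bot_iff_center_eq_top G).mpr htop
  have hcard := h.2.2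
  rw [h.2.1, hbot, Subgroup.card_bot] at hcard
  norm_num at hcard

theorem mul_self_mem_center (h : IsExtraspecial 2 G) (g : G) : g * g ∈ Subgroup.center G := by
  obtain ⟨z, -, hzz, hcenter⟩ := h.exists_mem_center_iff
  rw [Subgroup.mem_center_iff]
  intro x
  have hc := h.commutatorElement_mem_center x g
  have hcc : ⁅x, g⁆ * ⁅x, g⁆ = 1 := by
    rcases (hcenter _).mp hc with e | e <;> rw [e]
    exacts [one_mul 1, hzz]
  have hxg : x * g = ⁅x, g⁆ * (g * x) := by simp [commutatorElement_def, mul_assoc]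
  calc x * (g * g) = ⁅x, g⁆ * g * (x * g) := by rw [← mul_assoc, hxg]; simp only [mul_assoc, hxg]
    _ = ⁅x, g⁆ * (g * ⁅x, g⁆) * (g * x) := by rw [hxg]; simp only [mul_assoc]
    _ = (⁅x, g⁆ * ⁅x, g⁆) * (g * g * x) := by
      rw [Subgroup.mem_center_iff.mp hc g]; simp only [mul_assoc]
    _ = g * g * x := by rw [hcc, one_mul]

theorem cod_linear [Fintype G] (h : IsExtraspecial 2 G) (l : G →* ℂˣ) (hl : l ≠ 1) :
    cod G (fun g ↦ (l g : ℂ)) = 2 := by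
  have hsq : ∀ g, l g = 1 ∨ l g = -1 := by
    intro g
    have hmem : g * g ∈ l.ker := Abelianization.commutator_subset_ker l
      (h.2.1 ▸ h.mul_self_mem_center g)
    rw [MonoidHom.mem_ker, map_mul] at hmem
    have hval := congrArg Units.val hmem
    rcases mul_self_eq_one_iff.mp hval with e | e
    · exact Or.inl (Units.ext e)
    · exact Or.inr (Units.ext e)
  have hrange : (l.range : Set ℂˣ) = {1, -1} := by
    obtain ⟨a, ha⟩ : ∃ a, l a ≠ 1 := by
      by_contra! hall
      exact hl (MonoidHom.ext hall)
    ext u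
    constructor
    · rintro ⟨g, rfl⟩
      exact hsq g
    · rintro (rfl | rfl)
      exacts [one_mem _, ⟨a, (hsq a).resolve_left ha⟩]
  have hindex : l.ker.index = 2 := by
    rw [Subgroup.index_ker, ← SetLike.coe_sort_coe, Nat.card_coe_set_eq, hrange]
    exact Set.ncard_pair fun e ↦ by
      have := congrArg Units.val e
      norm_num at this
  have hker : (kerSet G fun g ↦ (l g : ℂ)).ncard = Nat.card l.ker := by
    rw [← SetLike.coe_sort_coe, Nat.card_coe_set_eq]
    congr 1
    ext g
    simp [kerSet]
  have hmul := l.ker.card_mul_index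
  rw [hindex, Nat.card_eq_fintype_card (α := G)] at hmul
  rw [cod, hker, ← hmul, Nat.mul_div_cancel_left _ Nat.card_pos]
  simp [charDeg]

theorem finrank_eq_one_of_rho_eq_one [Fintype G] (h : IsExtraspecial 2 G) {z : G}
    (hcenter : ∀ g, g ∈ Subgroup.center G ↔ g = 1 ∨ g = z) (V : FDRep ℂ G) [Simple V]
    (hV : V.ρ z = 1) : Module.finrank ℂ V = 1 := by
  refine V.finrank_eq_one_of_forall_eq_smul_one fun g ↦
    V.exists_eq_smul_one_of_commute _ fun x ↦ ?_
  have hgx : g * x = ⁅g, x⁆ * (x * g) := by simp [commutatorElement_def, mul_assoc]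
  have hc : V.ρ ⁅g, x⁆ = 1 := by
    rcases (hcenter _).mp (h.commutatorElement_mem_center g x) with e | e <;> rw [e]
    exacts [map_one _, hV]
  rw [Commute, SemiconjBy, ← map_mul, hgx, map_mul, hc, one_mul, map_mul]

theorem rho_eq_neg_one {z : G} (hz : z ∈ Subgroup.center G) (hzz : z * z = 1)
    (V : FDRep ℂ G) [Simple V] (hV : V.ρ z ≠ 1) : V.ρ z = -1 := by
  obtain ⟨c, hc⟩ := V.exists_eq_smul_one_of_commute (V.ρ z) fun g ↦ by
    rw [Commute, SemiconjBy, ← map_mul, ← map_mul, Subgroup.mem_center_iff.mp hz g]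
  have hsq : (c * c) • (1 : V →ₗ[ℂ] V) = (1 : ℂ) • 1 := by
    have h1 : V.ρ z * V.ρ z = 1 := by rw [← map_mul, hzz, map_one]
    rwa [hc, smul_mul_smul_comm, one_mul, ← one_smul ℂ (1 : V →ₗ[ℂ] V), smul_smul, mul_one] at h1
  have : Nontrivial (V →ₗ[ℂ] V) := ⟨_, _, hV⟩
  rcases mul_self_eq_one_iff.mp (smul_left_injective ℂ one_ne_zero hsq) with rfl | rfl
  · exact absurd (by rw [hc, one_smul]) hV
  · rw [hc, neg_smul, one_smul]

theorem character_eq [DecidableEq G] (h : IsExtraspecial 2 G) {z : G} (hzz : z * z = 1)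
    (hcenter : ∀ g, g ∈ Subgroup.center G ↔ g = 1 ∨ g = z)
    (V : FDRep ℂ G) [Simple V] (hV : V.ρ z ≠ 1) (g : G) :
    V.character g = if g = 1 then (Module.finrank ℂ V : ℂ)
      else if g = z then -(Module.finrank ℂ V : ℂ) else 0 := by
  have hneg := rho_eq_neg_one ((hcenter z).mpr (Or.inr rfl)) hzz V hV
  split_ifs with h1 h2
  · rw [h1, FDRep.char_one]
  · rw [h2, FDRep.character, hneg, map_neg, LinearMap.trace_one]
  · have hg : g ∉ Subgroup.center G := fun hg ↦ ((hcenter g).mp hg).elim h1 h2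
    obtain ⟨x, hx⟩ : ∃ x, x * g ≠ g * x := by
      simpa [Subgroup.mem_center_iff] using hg
    have hcomm : ⁅x, g⁆ = z := ((hcenter _).mp (h.commutatorElement_mem_center x g)).resolve_left
      fun e ↦ hx (commutatorElement_eq_one_iff_mul_comm.mp e)
    have hconj : x * g * x⁻¹ = z * g := by rw [← hcomm]; simp [commutatorElement_def]
    have hself : V.character g = -V.character g := by
      calc V.character g = V.character (x * g * x⁻¹) := (V.char_conj g x).symm
        _ = -V.character g := by
          rw [hconj, FDRep.character, map_mul, hneg, neg_one_mul, map_neg, FDRep.character]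
    exact self_eq_neg.mp hself

theorem two_mul_finrank_sq [Fintype G] (h : IsExtraspecial 2 G) {z : G} (hz1 : z ≠ 1)
    (hzz : z * z = 1) (hcenter : ∀ g, g ∈ Subgroup.center G ↔ g = 1 ∨ g = z)
    (V : FDRep ℂ G) [hVs : Simple V] (hV : V.ρ z ≠ 1) :
    2 * Module.finrank ℂ V ^ 2 = Fintype.card G := by
  classical
  have hnorm := (FDRep.simple_iff_char_is_norm_one V).mp hVs
  have hzinv : z⁻¹ = z := inv_eq_of_mul_eq_one_left hzz
  rw [← Finset.sum_subset (Finset.subset_univ {1, z}), Finset.sum_pair hz1.symm, inv_one,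
    hzinv] at hnorm
  · simp only [h.character_eq hzz hcenter V hV, if_true, if_neg hz1,
      Nat.card_eq_fintype_card] at hnorm
    have hsq : 2 * (Module.finrank ℂ V : ℂ) ^ 2 = Fintype.card G := by
      rw [← hnorm]
      ring
    exact_mod_cast hsq
  · intro g _ hg
    simp only [Finset.mem_insert, Finset.mem_singleton, not_or] at hg
    rw [h.character_eq hzz hcenter V hV g, if_neg hg.1, if_neg hg.2, zero_mul]

theorem finrank_ne_one [Fintype G] (h : IsExtraspecial 2 G) {z : G} (hz1 : z ≠ 1)
    (hzz : z * z = 1) (hcenter : ∀ g, g ∈ Subgroup.center G ↔ g = 1 ∨ g = z)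
    (V : FDRep ℂ G) [Simple V] (hV : V.ρ z ≠ 1) : Module.finrank ℂ V ≠ 1 := by
  intro hd
  have hcard := h.two_mul_finrank_sq hz1 hzz hcenter V hV
  rw [hd, ← Nat.card_eq_fintype_card] at hcard
  exact h.center_ne_top (Subgroup.eq_top_of_card_eq _ (by rw [h.2.2, ← hcard]; norm_num))

theorem cod_nonlinear [Fintype G] (h : IsExtraspecial 2 G) {χ : G → ℂ} (hχ : χ ∈ Irr G)
    (hd : charDeg G χ ≠ 1) : 2 < cod G χ := by
  classical
  obtain ⟨z, hz1, hzz, hcenter⟩ := h.exists_mem_center_iff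
  obtain ⟨V, hVs, rfl⟩ := hχ
  rw [charDeg_character] at hd
  have hV : V.ρ z ≠ 1 := fun e ↦ hd (h.finrank_eq_one_of_rho_eq_one hcenter V e)
  have hcard := h.two_mul_finrank_sq hz1 hzz hcenter V hV
  have hpos : 0 < Module.finrank ℂ V := by
    rw [Nat.pos_iff_ne_zero]
    intro h0
    rw [h0] at hcard
    exact Fintype.card_ne_zero (α := G) hcard.symm
  have hker : kerSet G V.character = {1} := by
    ext g
    simp only [kerSet, Set.mem_ofPred_eq, Set.mem_singleton_iff]
    refine ⟨fun hg ↦ ?_, fun hg ↦ by rw [hg]⟩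
    have hne : (Module.finrank ℂ V : ℂ) ≠ 0 := by exact_mod_cast hpos.ne'
    by_contra hg1
    rw [h.character_eq hzz hcenter V hV g, if_neg hg1, FDRep.char_one] at hg
    split_ifs at hg
    · exact hne (neg_eq_self.mp hg)
    · exact hne hg.symm
  rw [cod, hker, Set.ncard_singleton, Nat.div_one, charDeg_character, ← hcard, pow_two,
    ← mul_assoc, Nat.mul_div_cancel _ hpos]
  omega

theorem exists_eq_of_charDeg_ne_one [Fintype G] (h : IsExtraspecial 2 G) :
    ∃ χ : G → ℂ, {χ ∈ Irr G | charDeg G χ ≠ 1} = {χ} := by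
  classical
  obtain ⟨z, hz1, hzz, hcenter⟩ := h.exists_mem_center_iff
  obtain ⟨V, hVs, hV⟩ := FDRep.exists_simple_rho_ne_one hz1
  refine ⟨V.character, Set.eq_singleton_iff_unique_mem.mpr ⟨⟨⟨V, hVs, rfl⟩, ?_⟩, ?_⟩⟩
  · rw [charDeg_character]
    exact h.finrank_ne_one hz1 hzz hcenter V hV
  · rintro _ ⟨⟨W, hWs, rfl⟩, hWd⟩
    rw [charDeg_character] at hWd
    have hW : W.ρ z ≠ 1 := fun e ↦ hWd (h.finrank_eq_one_of_rho_eq_one hcenter W e)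
    have hsq : Module.finrank ℂ W = Module.finrank ℂ V := by
      have hVW := (h.two_mul_finrank_sq hz1 hzz hcenter W hW).trans
        (h.two_mul_finrank_sq hz1 hzz hcenter V hV).symm
      exact Nat.pow_left_injective two_ne_zero (Nat.mul_left_cancel two_pos hVW)
    funext g
    rw [h.character_eq hzz hcenter W hW, h.character_eq hzz hcenter V hV, hsq]

end IsExtraspecial

theorem cod_trivial (G : Type) [Group G] [Fintype G] : cod G (fun _ ↦ (1 : ℂ)) = 1 := by
  have hker : kerSet G (fun _ ↦ (1 : ℂ)) = Set.univ := by simp [kerSet]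
  rw [cod, hker, Set.ncard_univ, Nat.card_eq_fintype_card, Nat.div_self Fintype.card_pos]
  simp [charDeg]

theorem cod_eq_two_of_charDeg_eq_one {G : Type} [Group G] [Fintype G] (h : IsExtraspecial 2 G)
    {χ : G → ℂ} (hχ : χ ∈ Irr G) (hd : charDeg G χ = 1) (hne : χ ≠ fun _ ↦ (1 : ℂ)) :
    cod G χ = 2 := by
  obtain ⟨l, rfl⟩ := (mem_Irr_and_charDeg_eq_one_iff χ).mp ⟨hχ, hd⟩
  refine h.cod_linear l ?_
  rintro rfl
  exact hne (by simp)

/-- An extra-special 2-group has exactly one nonlinear irreducible character,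
all `|G/G'| - 1` nontrivial linear characters have codegree 2, and `G` is a
`T'_{|G/G'| - 1}`-group. -/
theorem extraspecial_Tk' (G : Type) [Group G] [Fintype G]
    (h : IsExtraspecial 2 G) :
    {χ ∈ Irr G | charDeg G χ ≠ 1}.ncard = 1 ∧
    (∀ χ ∈ Irr G, charDeg G χ = 1 → χ ≠ (fun _ => (1 : ℂ)) → cod G χ = 2) ∧
    {χ ∈ Irr G | charDeg G χ = 1 ∧ χ ≠ (fun _ => (1 : ℂ))}.ncard =
      Nat.card (G ⧸ commutator G) - 1 ∧
    IsTk' G (Nat.card (G ⧸ commutator G) - 1) := by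
  obtain ⟨χ₀, hχ₀⟩ := h.exists_eq_of_charDeg_ne_one
  have hlin : ∀ χ ∈ Irr G, charDeg G χ = 1 → χ ≠ (fun _ => (1 : ℂ)) → cod G χ = 2 :=
    fun χ hχ hd hne ↦ cod_eq_two_of_charDeg_eq_one h hχ hd hne
  have hcount := ncard_nontrivial_linear G
  have hcases : ∀ χ ∈ Irr G, cod G χ ≠ 2 → χ = (fun _ => (1 : ℂ)) ∨ χ = χ₀ := by
    intro χ hχ hcod
    by_cases hd : charDeg G χ = 1
    · exact Or.inl (by_contra fun hne ↦ hcod (hlin χ hχ hd hne))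
    · exact Or.inr (hχ₀.subset ⟨hχ, hd⟩)
  have htwo : {χ ∈ Irr G | cod G χ = 2} =
      {χ ∈ Irr G | charDeg G χ = 1 ∧ χ ≠ (fun _ => (1 : ℂ))} := by
    ext χ
    refine ⟨fun ⟨hχ, hcod⟩ ↦ ⟨hχ, by_contra fun hd ↦ (h.cod_nonlinear hχ hd).ne' hcod, ?_⟩,
      fun ⟨hχ, hd, hne⟩ ↦ ⟨hχ, hlin χ hχ hd hne⟩⟩
    rintro rfl
    rw [cod_trivial] at hcod
    omega
  refine ⟨by rw [hχ₀, Set.ncard_singleton], hlin, hcount, 2, ?_, ?_, ?_⟩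
  · have hindex : (commutator G).index ≠ 1 := fun e ↦
      h.center_ne_top (h.2.1.trans (Subgroup.index_eq_one.mp e))
    have hpos : 0 < (commutator G).index := Nat.pos_of_ne_zero Subgroup.index_ne_zero_of_finite
    have hne : {χ ∈ Irr G | cod G χ = 2}.ncard ≠ 0 := by
      rw [htwo, hcount]
      change (commutator G).index - 1 ≠ 0
      omega
    exact Set.nonempty_of_ncard_ne_zero hne
  · rw [codMult, htwo, hcount]
  · rintro _ ⟨χ, hχ, rfl⟩ hcod
    have hχ₀cod : 2 < cod G χ₀ := by
      obtain ⟨hmem, hd⟩ := hχ₀.superset (Set.mem_singleton χ₀)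
      exact h.cod_nonlinear hmem hd
    rw [codMult, Set.ncard_eq_one]
    refine ⟨χ, Set.eq_singleton_iff_unique_mem.mpr ⟨⟨hχ, rfl⟩, fun ψ ⟨hψ, hψcod⟩ ↦ ?_⟩⟩
    have htriv := cod_trivial G
    rcases hcases χ hχ hcod with rfl | rfl <;> rcases hcases ψ hψ (hψcod ▸ hcod) with rfl | rfl
    · rfl
    · omega
    · omega
    · rfl
end

section
/- The dihedral group D_{18} of order 18 is a T'₃-group: the codegree 9 is attained by exactly 3 irreducible characters and every other codegree is attained by exactly one irreducible character. -/
open CategoryTheory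

open DihedralGroup ZMod

section Irr

variable {G : Type} [Group G] [Fintype G]

/-- The trace of a matrix representation whose character has norm one is an irreducible
character. -/
theorem trace_mem_Irr {ι : Type} [Fintype ι] [DecidableEq ι] (φ : G →* Matrix ι ι ℂ)
    (h : ∑ g : G, (φ g).trace * (φ g⁻¹).trace = Fintype.card G) :
    (fun g => (φ g).trace) ∈ Irr G := by
  let ρ : Representation ℂ G (ι → ℂ) :=
    (Matrix.toLinAlgEquiv' : Matrix ι ι ℂ ≃ₐ[ℂ] _).toMulEquiv.toMonoidHom.comp φ
  have hρ : ∀ g, (FDRep.of ρ).character g = (φ g).trace := fun g =>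
    Matrix.trace_toLin'_eq (φ g)
  refine ⟨FDRep.of ρ, ?_, funext fun g => (hρ g).symm⟩
  rw [FDRep.simple_iff_char_is_norm_one]
  simp only [hρ, h, Nat.card_eq_fintype_card]

/-- If a linear combination of irreducible characters is the regular character, then every
irreducible character occurs in it. -/
theorem Irr_subset_range [DecidableEq G] {ι : Type} [Fintype ι] (ψ : ι → G → ℂ) (hψ : ∀ i, ψ i ∈ Irr G)
    (c : ι → ℂ) (h : ∀ g, ∑ i, c i * ψ i g = if g = 1 then (Fintype.card G : ℂ) else 0) :
    Irr G ⊆ Set.range ψ := by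
  rintro χ ⟨V, hV, rfl⟩
  by_contra hne
  have hcard : (Fintype.card G : ℂ) ≠ 0 := Nat.cast_ne_zero.2 Fintype.card_ne_zero
  have hcard' : (Nat.card G : ℂ) ≠ 0 := by rwa [Nat.card_eq_fintype_card]
  let : Invertible (Nat.card G : ℂ) := invertibleOfNonzero hcard'
  have orth : ∀ i, ∑ g, V.character g * ψ i g⁻¹ = 0 := by
    intro i
    obtain ⟨W, hW, hWψ⟩ := hψ i
    have key := FDRep.char_orthonormal V W
    rw [if_neg (fun ⟨e⟩ => hne ⟨i, hWψ.trans (FDRep.char_iso e).symm⟩)] at key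
    rw [hWψ]
    exact (mul_eq_zero.1 key).resolve_left (inv_ne_zero hcard')
  have deg : V.character 1 * Fintype.card G = 0 := by
    calc V.character 1 * Fintype.card G
        = ∑ g, V.character g * ∑ i, c i * ψ i g⁻¹ := by simp [h]
      _ = ∑ i, c i * ∑ g, V.character g * ψ i g⁻¹ := by
          simp only [Finset.mul_sum]
          rw [Finset.sum_comm]
          exact Finset.sum_congr rfl fun i _ => Finset.sum_congr rfl fun g _ => by ring
      _ = 0 := by simp [orth]
  have hV1 : V.character 1 = 0 := (mul_eq_zero.1 deg).resolve_right hcard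
  have hfin : Module.finrank ℂ V = 0 := by
    rw [FDRep.char_one] at hV1
    exact_mod_cast hV1
  have hzero : ∀ g, V.character g = 0 := fun g => by
    have := Module.finrank_zero_iff.1 hfin
    rw [FDRep.character, Subsingleton.elim (V.ρ g) 0, map_zero]
  have norm := (FDRep.simple_iff_char_is_norm_one V).1 hV
  simp only [hzero, zero_mul, Finset.sum_const_zero] at norm
  exact hcard' norm.symm

end Irr

namespace DihedralGroup

variable {n : ℕ}

/-- The linear character that is trivial on rotations and sends reflections to `ε`. -/
def linearChar (n : ℕ) (ε : ℂ) : DihedralGroup n → ℂ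
  | r _ => 1
  | sr _ => ε

/-- The linear representation affording `linearChar`. -/
def linearRep (n : ℕ) {ε : ℂ} (hε : ε * ε = 1) : DihedralGroup n →* ℂ where
  toFun := linearChar n ε
  map_one' := rfl
  map_mul' := by
    rintro (i | i) (j | j) <;> simp [linearChar, hε]

theorem linearRep_apply {ε : ℂ} (hε : ε * ε = 1) (g : DihedralGroup n) :
    linearRep n hε g = linearChar n ε g :=
  rfl

theorem charDeg_linearChar (ε : ℂ) : charDeg (DihedralGroup n) (linearChar n ε) = 1 := by
  simp [charDeg, one_def, linearChar, -r_zero]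

variable [NeZero n]

theorem sum_eq_sum_r_add_sum_sr {M : Type*} [AddCommMonoid M] (f : DihedralGroup n → M) :
    ∑ g, f g = ∑ i, f (r i) + ∑ i, f (sr i) := by
  rw [← equivSum.symm.sum_comp, Fintype.sum_sum_type]
  rfl

/-- The character of the two-dimensional representation in which `r 1` has eigenvalues
`exp (± 2 π i k / n)`. -/
noncomputable def planeChar (k : ZMod n) : DihedralGroup n → ℂ
  | r i => stdAddChar (k * i) + stdAddChar (-(k * i))
  | sr _ => 0

/-- The matrix representation affording `planeChar`. -/
noncomputable def planeRep (k : ZMod n) : DihedralGroup n →* Matrix (Fin 2) (Fin 2) ℂ where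
  toFun
    | r i => !![stdAddChar (k * i), 0; 0, stdAddChar (-(k * i))]
    | sr i => !![0, stdAddChar (-(k * i)); stdAddChar (k * i), 0]
  map_one' := by
    rw [one_def]
    simp [Matrix.one_fin_two]
  map_mul' := by
    rintro (i | i) (j | j) <;>
      simp only [r_mul_r, r_mul_sr, sr_mul_r, sr_mul_sr, Matrix.mul_fin_two,
        ← AddChar.map_add_eq_mul, mul_zero, zero_mul, add_zero, zero_add] <;>
      ring_nf

theorem sum_stdAddChar_mul (t : ZMod n) :
    ∑ i : ZMod n, (stdAddChar (t * i) : ℂ) = if t = 0 then (n : ℂ) else 0 := by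
  simpa [mul_comm, ZMod.card] using AddChar.sum_mulShift t (isPrimitive_stdAddChar n)

theorem linearChar_mem_Irr {ε : ℂ} (hε : ε * ε = 1) : linearChar n ε ∈ Irr (DihedralGroup n) := by
  let φ := ((Matrix.scalar (Fin 1)).toMonoidHom : ℂ →* _).comp (linearRep n hε)
  have hφ : ∀ g, (φ g).trace = linearChar n ε g := fun g => by
    simp [φ, Matrix.trace, linearRep_apply]
  have := trace_mem_Irr φ (by
    simp only [hφ, sum_eq_sum_r_add_sum_sr, DihedralGroup.card]
    simp [linearChar, hε, ZMod.card, two_mul])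
  simpa only [hφ] using this

theorem planeChar_mem_Irr {k : ZMod n} (hk : 2 * k ≠ 0) :
    planeChar k ∈ Irr (DihedralGroup n) := by
  have hφ : ∀ g, (planeRep k g).trace = planeChar k g := by
    rintro (i | i) <;> simp [planeRep, planeChar, Matrix.trace_fin_two]
  have := trace_mem_Irr (planeRep k) (by
    simp only [hφ, sum_eq_sum_r_add_sum_sr, DihedralGroup.card, inv_r, inv_sr]
    have expand : ∀ i : ZMod n, planeChar k (r i) * planeChar k (r (-i)) =
        stdAddChar (2 * k * i) + stdAddChar (-(2 * k) * i) + 2 := by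
      intro i
      have h : (stdAddChar (k * i) : ℂ) * stdAddChar (-(k * i)) = 1 := by
        rw [← AddChar.map_add_eq_mul, add_neg_cancel, AddChar.map_zero_eq_one]
      rw [show 2 * k * i = k * i + k * i by ring,
        show -(2 * k) * i = -(k * i) + -(k * i) by ring, AddChar.map_add_eq_mul,
        AddChar.map_add_eq_mul]
      simp only [planeChar, mul_neg, neg_neg]
      linear_combination 2 * h
    simp only [expand, Finset.sum_add_distrib, sum_stdAddChar_mul, neg_eq_zero, if_neg hk]
    simp [planeChar, ZMod.card, mul_comm])
  simpa only [hφ] using this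

theorem planeChar_one (k : ZMod n) : planeChar k 1 = 2 := by
  rw [one_def]
  simp only [planeChar, mul_zero, neg_zero, AddChar.map_zero_eq_one]
  norm_num

theorem planeChar_r_eq_iff (k l i : ZMod n) :
    planeChar k (r i) = planeChar l (r i) ↔ k * i = l * i ∨ k * i = -(l * i) := by
  have inv : ∀ x : ZMod n, (stdAddChar x : ℂ) * stdAddChar (-x) = 1 := fun x => by
    rw [← AddChar.map_add_eq_mul, add_neg_cancel, AddChar.map_zero_eq_one]
  constructor
  · intro h
    simp only [planeChar] at h
    have factor : (stdAddChar (k * i) - stdAddChar (l * i) : ℂ) *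
        (stdAddChar (k * i) - stdAddChar (-(l * i))) = 0 := by
      linear_combination stdAddChar (k * i) * h - inv (k * i) + inv (l * i)
    refine (mul_eq_zero.1 factor).imp ?_ ?_ <;>
      exact fun h => injective_stdAddChar (sub_eq_zero.1 h)
  · rintro (h | h) <;> simp [planeChar, h, add_comm]

theorem planeChar_ne {k l : ZMod n} (h : k ≠ l) (h' : k ≠ -l) : planeChar k ≠ planeChar l := by
  intro e
  have := (planeChar_r_eq_iff k l 1).1 (congrFun e _)
  simp only [mul_one] at this
  exact this.elim h h'

theorem kerSet_planeChar (k : ZMod n) :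
    kerSet (DihedralGroup n) (planeChar k) = r '' {i | k * i = 0} := by
  ext g
  rcases g with i | i
  · have h0 : planeChar (0 : ZMod n) (r i) = 2 := by
      simp only [planeChar, zero_mul, neg_zero, AddChar.map_zero_eq_one]
      norm_num
    have := planeChar_r_eq_iff k 0 i
    rw [h0] at this
    simp [kerSet, planeChar_one, this]
  · have h0 : planeChar k (sr i) = 0 := rfl
    simp [kerSet, planeChar_one, h0]

theorem cod_planeChar (k : ZMod n) :
    cod (DihedralGroup n) (planeChar k) =
      2 * n / (Finset.univ.filter fun i : ZMod n => k * i = 0).card / 2 := by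
  have hker : (kerSet (DihedralGroup n) (planeChar k)).ncard =
      (Finset.univ.filter fun i : ZMod n => k * i = 0).card := by
    rw [kerSet_planeChar, Set.ncard_image_of_injective _ fun _ _ h => r.inj h,
      ← Set.ncard_coe_finset]
    simp
  have hdeg : charDeg (DihedralGroup n) (planeChar k) = 2 := by
    simp [charDeg, planeChar_one]
  rw [cod, hker, hdeg, DihedralGroup.card]

theorem cod_linearChar_one : cod (DihedralGroup n) (linearChar n 1) = 1 := by
  have hker : kerSet (DihedralGroup n) (linearChar n 1) = Set.univ := by
    ext (i | i) <;> simp [kerSet, one_def, linearChar, -r_zero]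
  rw [cod, charDeg_linearChar, hker, Set.ncard_univ, Nat.card_eq_fintype_card,
    Nat.div_self Fintype.card_pos]

theorem cod_linearChar_neg_one : cod (DihedralGroup n) (linearChar n (-1)) = 2 := by
  have hker : kerSet (DihedralGroup n) (linearChar n (-1)) = Set.range r := by
    ext (i | i)
    · simp [kerSet, one_def, linearChar, -r_zero]
    · simp only [kerSet, one_def, linearChar, Set.mem_ofPred_eq, Set.mem_range, reduceCtorEq,
        exists_false, iff_false]
      norm_num
  rw [cod, charDeg_linearChar, hker, ← Set.image_univ,
    Set.ncard_image_of_injective _ fun _ _ h => r.inj h, Set.ncard_univ, Nat.card_zmod,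
    DihedralGroup.card, Nat.mul_div_cancel _ (NeZero.pos n)]

theorem Irr_nine : Irr (DihedralGroup 9) =
    {linearChar 9 1, linearChar 9 (-1), planeChar 1, planeChar 2, planeChar 3, planeChar 4} := by
  let ψ : Fin 6 → DihedralGroup 9 → ℂ :=
    ![linearChar 9 1, linearChar 9 (-1), planeChar 1, planeChar 2, planeChar 3, planeChar 4]
  have hψ : ∀ i, ψ i ∈ Irr (DihedralGroup 9) := by
    intro i
    fin_cases i
    · exact linearChar_mem_Irr (by norm_num)
    · exact linearChar_mem_Irr (by norm_num)
    all_goals exact planeChar_mem_Irr (by decide)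
  have regular : ∀ g, ∑ i, (![1, 1, 2, 2, 2, 2] : Fin 6 → ℂ) i * ψ i g =
      if g = 1 then (Fintype.card (DihedralGroup 9) : ℂ) else 0 := by
    rintro (i | i)
    · have hsum : ∑ k : ZMod 9, (stdAddChar (k * i) : ℂ) = if i = 0 then 9 else 0 := by
        simpa only [mul_comm, Nat.cast_ofNat] using sum_stdAddChar_mul i
      have hone : (r i = (1 : DihedralGroup 9)) ↔ i = 0 := by simp [one_def, -r_zero]
      have hneg : ∀ k l : ZMod 9, l = -k → -(k * i) = l * i := fun k l h => by rw [h, neg_mul]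
      have huniv : (Finset.univ : Finset (ZMod 9)) = {0, 1, 2, 3, 4, 5, 6, 7, 8} := by decide
      have hlist : ∑ k : ZMod 9, (stdAddChar (k * i) : ℂ) = 1 +
          (planeChar 1 (r i) + planeChar 2 (r i) + planeChar 3 (r i) + planeChar 4 (r i)) := by
        simp only [planeChar, hneg 1 8 (by decide), hneg 2 7 (by decide), hneg 3 6 (by decide),
          hneg 4 5 (by decide)]
        rw [huniv]
        repeat rw [Finset.sum_insert (by decide)]
        rw [Finset.sum_singleton, zero_mul, AddChar.map_zero_eq_one]
        ring
      calc ∑ j, (![1, 1, 2, 2, 2, 2] : Fin 6 → ℂ) j * ψ j (r i)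
          = 2 * ∑ k : ZMod 9, (stdAddChar (k * i) : ℂ) := by
            rw [hlist]
            simp only [ψ, Fin.sum_univ_six, Matrix.cons_val, linearChar]
            ring
        _ = _ := by
            rw [hsum, DihedralGroup.card]
            simp only [hone]
            split_ifs <;> norm_num
    · simp [ψ, Fin.sum_univ_succ, linearChar, planeChar, one_def, -r_zero]
  have hrange : Irr (DihedralGroup 9) = Set.range ψ :=
    (Irr_subset_range ψ hψ _ regular).antisymm (Set.range_subset_iff.2 hψ)
  rw [hrange]
  ext χ
  simp only [ψ, Matrix.range_cons, Matrix.range_empty, Set.union_empty, Set.mem_union,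
    Set.mem_singleton_iff, Set.mem_insert_iff]

end DihedralGroup

/-- `D₁₈` is a `T'₃`-group: codegree 9 has multiplicity 3 and all other
codegrees have multiplicity 1. -/
theorem d18_Tk' :
    9 ∈ codSet (DihedralGroup 9) ∧ codMult (DihedralGroup 9) 9 = 3 ∧
    (∀ d ∈ codSet (DihedralGroup 9), d ≠ 9 → codMult (DihedralGroup 9) d = 1) ∧
    IsTk' (DihedralGroup 9) 3 := by
  have c₁ : cod (DihedralGroup 9) (planeChar 1) = 9 := (cod_planeChar _).trans (by decide)
  have c₂ : cod (DihedralGroup 9) (planeChar 2) = 9 := (cod_planeChar _).trans (by decide)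
  have c₃ : cod (DihedralGroup 9) (planeChar 3) = 3 := (cod_planeChar _).trans (by decide)
  have c₄ : cod (DihedralGroup 9) (planeChar 4) = 9 := (cod_planeChar _).trans (by decide)
  have ct : cod (DihedralGroup 9) (linearChar 9 1) = 1 := cod_linearChar_one
  have cs : cod (DihedralGroup 9) (linearChar 9 (-1)) = 2 := cod_linearChar_neg_one
  have mem : 9 ∈ codSet (DihedralGroup 9) :=
    ⟨planeChar 1, by simp [Irr_nine], c₁⟩
  have mult : codMult (DihedralGroup 9) 9 = 3 := by
    have : {χ ∈ Irr (DihedralGroup 9) | cod (DihedralGroup 9) χ = 9} =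
        {planeChar 1, planeChar 2, planeChar 4} := by
      ext χ
      simp only [Irr_nine, Set.mem_ofPred_eq, Set.mem_insert_iff, Set.mem_singleton_iff]
      grind
    rw [codMult, this, Set.ncard_eq_three]
    exact ⟨_, _, _, planeChar_ne (by decide) (by decide), planeChar_ne (by decide) (by decide),
      planeChar_ne (by decide) (by decide), rfl⟩
  have rest : ∀ d ∈ codSet (DihedralGroup 9), d ≠ 9 → codMult (DihedralGroup 9) d = 1 := by
    rintro d ⟨χ, hχ, rfl⟩ hd
    rw [codMult, Set.ncard_eq_one]
    refine ⟨χ, ?_⟩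
    ext χ'
    simp only [Irr_nine, Set.mem_ofPred_eq, Set.mem_insert_iff, Set.mem_singleton_iff] at hχ ⊢
    grind
  exact ⟨mem, mult, rest, 9, mem, mult, rest⟩
end
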